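/- Let α, β ∈ (0,1) with α + β < 1 and let f₀(x,y) = Σ_{j=1}^{∞} M_j^{−(α+β)} r_j(x) r_j(y) ∈ C(G_m²). Then there exist a constant c(α,β) > 0 and N ∈ ℕ such that for all integers n ≥ N, ‖σ_{M_n,M_n}^{−α,−β}(f₀) − f₀‖₁ ≥ c(α,β). In particular, lim sup_{n→∞} ‖σ_{M_n,M_n}^{−α,−β}(f₀) − f₀‖₁ > 0. -/

import Mathlib

open MeasureTheory Filter Finset
open scoped ENNReal NNReal Real

noncomputable section

namespace Vilenkin

/-- The bounded Vilenkin group: complete direct product of the cyclic groups `ZMod (m k)`. -/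
abbrev G (m : ℕ → ℕ) : Type := ∀ k, ZMod (m k)

/-- The generalized number system `M 0 = 1`, `M (k+1) = m k * M k`. -/
def M (m : ℕ → ℕ) : ℕ → ℕ
  | 0 => 1
  | k + 1 => m k * M m k

/-- The cylinder neighbourhood `I n = {x | x 0 = ⋯ = x (n-1) = 0}`. -/
def I (m : ℕ → ℕ) (n : ℕ) : Set (G m) := {x | ∀ j < n, x j = 0}

/-- The `j`-th digit of `n` in the generalized number system based on `m`. -/
def digit (m : ℕ → ℕ) (n j : ℕ) : ℕ := n / M m j % m j

/-- The generalized Rademacher functions `r k x = exp (2 π i x_k / m_k)`. -/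
def rad (m : ℕ → ℕ) (k : ℕ) (x : G m) : ℂ :=
  Complex.exp (2 * Real.pi * Complex.I * ((x k).val : ℂ) / (m k : ℂ))

/-- The Vilenkin system `ψ n = ∏ k, (r k) ^ (n_k)`. -/
def psi (m : ℕ → ℕ) (n : ℕ) (x : G m) : ℂ :=
  ∏ k ∈ Finset.range (n + 1), rad m k x ^ digit m n k

/-- The Vilenkin-Dirichlet kernels `D n = ∑_{k<n} ψ k`. -/
def D (m : ℕ → ℕ) (n : ℕ) (x : G m) : ℂ := ∑ k ∈ Finset.range n, psi m k x

/-- The Cesàro numbers `A n α = (α+1)⋯(α+n)/n!`. -/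
def A (α : ℝ) (n : ℕ) : ℝ := (∏ i ∈ Finset.range n, (α + (i + 1))) / (n.factorial : ℝ)

/-- One-dimensional Vilenkin-Fourier coefficients. -/
def fhat1 (m : ℕ → ℕ) (μ : Measure (G m)) (f : G m → ℂ) (i : ℕ) : ℂ :=
  ∫ x, f x * (starRingEnd ℂ) (psi m i x) ∂μ

/-- One-dimensional `(C,-α)` Cesàro means of the Vilenkin-Fourier series. -/
def cesaro1 (m : ℕ → ℕ) (μ : Measure (G m)) (α : ℝ) (f : G m → ℂ) (n : ℕ) (x : G m) : ℂ :=
  ((A (-α) n : ℝ) : ℂ)⁻¹ *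
    ∑ i ∈ Finset.range (n + 1), ((A (-α) (n - i) : ℝ) : ℂ) * fhat1 m μ f i * psi m i x

/-- Double Vilenkin-Fourier coefficients. -/
def fhat2 (m : ℕ → ℕ) (μ : Measure (G m)) (f : G m × G m → ℂ) (i j : ℕ) : ℂ :=
  ∫ z, f z * (starRingEnd ℂ) (psi m i z.1) * (starRingEnd ℂ) (psi m j z.2) ∂(μ.prod μ)

/-- Rectangular partial sums of the double Vilenkin-Fourier series. -/
def partialSum2 (m : ℕ → ℕ) (μ : Measure (G m)) (f : G m × G m → ℂ) (n₁ n₂ : ℕ)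
    (z : G m × G m) : ℂ :=
  ∑ k₁ ∈ Finset.range n₁, ∑ k₂ ∈ Finset.range n₂,
    fhat2 m μ f k₁ k₂ * psi m k₁ z.1 * psi m k₂ z.2

/-- The `(C,-α,-β)` means of the double Vilenkin-Fourier series. -/
def cesaro2 (m : ℕ → ℕ) (μ : Measure (G m)) (α β : ℝ) (f : G m × G m → ℂ) (n₁ n₂ : ℕ)
    (z : G m × G m) : ℂ :=
  ((A (-α) n₁ * A (-β) n₂ : ℝ) : ℂ)⁻¹ *
    ∑ i ∈ Finset.range (n₁ + 1), ∑ j ∈ Finset.range (n₂ + 1),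
      ((A (-α) (n₁ - i) * A (-β) (n₂ - j) : ℝ) : ℂ) * fhat2 m μ f i j * psi m i z.1 * psi m j z.2

/-- One-dimensional modulus of continuity in `L^p`. -/
def omegaOne (m : ℕ → ℕ) (μ : Measure (G m)) (p : ℝ≥0∞) (f : G m → ℂ) (n : ℕ) : ℝ≥0∞ :=
  ⨆ u ∈ I m n, eLpNorm (fun x => f (x - u) - f x) p μ

/-- First partial modulus of continuity in `L^p`. -/
def omega1 (m : ℕ → ℕ) (μ : Measure (G m)) (p : ℝ≥0∞) (f : G m × G m → ℂ) (n : ℕ) : ℝ≥0∞ :=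
  ⨆ u ∈ I m n, eLpNorm (fun z => f (z.1 - u, z.2) - f z) p (μ.prod μ)

/-- Second partial modulus of continuity in `L^p`. -/
def omega2 (m : ℕ → ℕ) (μ : Measure (G m)) (p : ℝ≥0∞) (f : G m × G m → ℂ) (n : ℕ) : ℝ≥0∞ :=
  ⨆ v ∈ I m n, eLpNorm (fun z => f (z.1, z.2 - v) - f z) p (μ.prod μ)

/-- Mixed modulus of continuity in `L^p`. -/
def omega12 (m : ℕ → ℕ) (μ : Measure (G m)) (p : ℝ≥0∞) (f : G m × G m → ℂ) (n l : ℕ) : ℝ≥0∞ :=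
  ⨆ u ∈ I m n, ⨆ v ∈ I m l,
    eLpNorm (fun z => f (z.1 - u, z.2 - v) - f (z.1 - u, z.2) - f (z.1, z.2 - v) + f z) p
      (μ.prod μ)

/-- Total modulus of continuity in `L^p`. -/
def omegaT (m : ℕ → ℕ) (μ : Measure (G m)) (p : ℝ≥0∞) (f : G m × G m → ℂ) (n : ℕ) : ℝ≥0∞ :=
  ⨆ u ∈ I m n, ⨆ v ∈ I m n, eLpNorm (fun z => f (z.1 - u, z.2 - v) - f z) p (μ.prod μ)

/-- Total modulus of continuity in the uniform norm. -/
def omegaC (m : ℕ → ℕ) (f : G m × G m → ℂ) (n : ℕ) : ℝ≥0∞ :=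
  ⨆ u ∈ I m n, ⨆ v ∈ I m n, ⨆ z : G m × G m, (‖f (z.1 - u, z.2 - v) - f z‖₊ : ℝ≥0∞)

theorem M_pos {m : ℕ → ℕ} (hm2 : ∀ k, 2 ≤ m k) (n : ℕ) : 0 < M m n := by
  induction n with
  | zero => simp [M]
  | succ k ih => exact Nat.mul_pos (by linarith [hm2 k]) ih

theorem two_pow_le_M {m : ℕ → ℕ} (hm2 : ∀ k, 2 ≤ m k) (n : ℕ) : 2 ^ n ≤ M m n := by
  induction n with
  | zero => simp [M]
  | succ k ih => rw [pow_succ', M]; exact Nat.mul_le_mul (hm2 k) ih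

theorem M_monotone {m : ℕ → ℕ} (hm2 : ∀ k, 2 ≤ m k) : Monotone (M m) :=
  monotone_nat_of_le_succ fun n => Nat.le_mul_of_pos_left _ (by linarith [hm2 n])

theorem M_dvd (m : ℕ → ℕ) {k n : ℕ} (h : k ≤ n) : M m k ∣ M m n := by
  induction n, h using Nat.le_induction with
  | base => exact dvd_rfl
  | succ n _ ih => exact ih.mul_left _

theorem digit_eq_zero_of_lt {m : ℕ → ℕ} {i k : ℕ} (h : i < M m k) : digit m i k = 0 := by
  simp [digit, Nat.div_eq_of_lt h]

theorem digit_M {m : ℕ → ℕ} (hm2 : ∀ k, 2 ≤ m k) (n k : ℕ) :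
    digit m (M m n) k = if k = n then 1 else 0 := by
  rcases lt_trichotomy k n with h | rfl | h
  · rw [if_neg h.ne, digit]
    obtain ⟨c, hc⟩ := M_dvd m (Nat.succ_le_of_lt h)
    rw [hc, Nat.succ_eq_add_one, M, mul_right_comm, Nat.mul_div_cancel _ (M_pos hm2 k)]
    simp
  · rw [if_pos rfl, digit, Nat.div_self (M_pos hm2 k), Nat.mod_eq_of_lt (hm2 k)]
  · rw [if_neg h.ne']
    refine digit_eq_zero_of_lt (lt_of_lt_of_le ?_ (M_monotone hm2 (Nat.succ_le_of_lt h)))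
    have h1 := M_pos hm2 n
    have h2 := hm2 n
    rw [Nat.succ_eq_add_one, M]
    nlinarith

theorem psi_M {m : ℕ → ℕ} (hm2 : ∀ k, 2 ≤ m k) (n : ℕ) (x : G m) :
    psi m (M m n) x = rad m n x := by
  have hn : n < M m n + 1 :=
    (Nat.lt_two_pow_self.trans_le (two_pow_le_M hm2 n)).trans (Nat.lt_succ_self _)
  rw [psi, Finset.prod_eq_single_of_mem n (Finset.mem_range.2 hn)]
  · simp [digit_M hm2]
  · intro k _ hk
    simp [digit_M hm2, hk]

theorem rad_eq_stdAddChar (m : ℕ → ℕ) [∀ k, NeZero (m k)] (k : ℕ) (x : G m) :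
    rad m k x = ZMod.stdAddChar (x k) := by
  rw [ZMod.stdAddChar_apply, ZMod.toCircle_apply, rad]

theorem norm_rad (m : ℕ → ℕ) [∀ k, NeZero (m k)] (k : ℕ) (x : G m) : ‖rad m k x‖ = 1 := by
  rw [rad_eq_stdAddChar, AddChar.norm_apply]

theorem norm_psi (m : ℕ → ℕ) [∀ k, NeZero (m k)] (i : ℕ) (x : G m) : ‖psi m i x‖ = 1 := by
  simp [psi, norm_prod, norm_rad]

@[fun_prop]
theorem measurable_rad (m : ℕ → ℕ) (k : ℕ) : Measurable (rad m k) :=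
  (Measurable.of_discrete (f := fun t : ZMod (m k) =>
    Complex.exp (2 * Real.pi * Complex.I * (t.val : ℂ) / (m k : ℂ)))).comp (measurable_pi_apply k)

@[fun_prop]
theorem measurable_psi (m : ℕ → ℕ) (i : ℕ) : Measurable (psi m i) := by
  unfold psi
  fun_prop

theorem rad_add_single (m : ℕ → ℕ) [∀ k, NeZero (m k)] (n : ℕ) (x : G m) :
    rad m n (x + Pi.single n 1) = ZMod.stdAddChar (1 : ZMod (m n)) * rad m n x := by
  simp [rad_eq_stdAddChar, AddChar.map_add_eq_mul, mul_comm]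

theorem rad_add_single_of_ne (m : ℕ → ℕ) {n k : ℕ} (h : k ≠ n) (x : G m) :
    rad m k (x + Pi.single n 1) = rad m k x := by
  simp [rad, h]

theorem psi_add_single_of_lt {m : ℕ → ℕ} {i n : ℕ} (h : i < M m n) (x : G m) :
    psi m i (x + Pi.single n 1) = psi m i x := by
  refine Finset.prod_congr rfl fun k _ => ?_
  rcases eq_or_ne k n with rfl | hk
  · simp [digit_eq_zero_of_lt h]
  · rw [rad_add_single_of_ne m hk]

/-- The cylinders generate the product `σ`-algebra of the Vilenkin group. -/
theorem generateFrom_cylinders (m : ℕ → ℕ) [∀ k, NeZero (m k)] :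
    (inferInstance : MeasurableSpace (G m)) = MeasurableSpace.generateFrom
      {s | s = ∅ ∨ ∃ (n : ℕ) (x : G m), s = {y : G m | ∀ j < n, y j = x j}} := by
  apply le_antisymm
  · refine iSup_le fun k => ?_
    rw [← measurable_iff_comap_le]
    let R : G m → ∀ i : Fin (k + 1), ZMod (m i) := fun y i => y i
    have hR : @Measurable _ _ (MeasurableSpace.generateFrom
        {s | s = ∅ ∨ ∃ (n : ℕ) (x : G m), s = {y : G m | ∀ j < n, y j = x j}}) _ R := by
      refine @measurable_to_countable _ _ _ _ (_) _ fun x => ?_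
      refine MeasurableSpace.measurableSet_generateFrom (Or.inr ⟨k + 1, x, ?_⟩)
      ext y
      simp only [Set.mem_preimage, Set.mem_singleton_iff, Set.mem_ofPred_eq, funext_iff, R]
      exact ⟨fun h j hj => h ⟨j, hj⟩, fun h i => h i i.2⟩
    exact @Measurable.comp _ _ _ (_) _ _ _ _
      (measurable_pi_apply (X := fun i : Fin (k + 1) => ZMod (m i)) (Fin.last k)) hR
  · refine MeasurableSpace.generateFrom_le ?_
    rintro s (rfl | ⟨n, x, rfl⟩)
    · exact MeasurableSet.empty
    · have : {y : G m | ∀ j < n, y j = x j} = ⋂ j : Fin n, {y : G m | y j = x j} := by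
        ext y
        simp only [Set.mem_ofPred_eq, Set.mem_iInter]
        exact ⟨fun h j => h j j.2, fun h j hj => h ⟨j, hj⟩⟩
      rw [this]
      exact MeasurableSet.iInter fun j =>
        measurableSet_eq_fun (measurable_pi_apply (j : ℕ)) measurable_const

theorem isPiSystem_cylinders (m : ℕ → ℕ) : IsPiSystem
    {s | s = ∅ ∨ ∃ (n : ℕ) (x : G m), s = {y : G m | ∀ j < n, y j = x j}} := by
  rintro s (rfl | ⟨n, x, rfl⟩) t (rfl | ⟨n', x', rfl⟩) ⟨z, hz, hz'⟩
  · exact Or.inl (by simp)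
  · exact Or.inl (by simp)
  · exact Or.inl (by simp)
  · refine Or.inr ⟨max n n', z, ?_⟩
    ext y
    simp only [Set.mem_inter_iff, Set.mem_ofPred_eq] at hz hz' ⊢
    constructor
    · rintro ⟨h, h'⟩ j hj
      rcases lt_max_iff.1 hj with hj | hj
      · rw [h j hj, hz j hj]
      · rw [h' j hj, hz' j hj]
    · intro h
      exact ⟨fun j hj => by rw [h j (lt_max_of_lt_left hj), hz j hj],
        fun j hj => by rw [h j (lt_max_of_lt_right hj), hz' j hj]⟩

theorem measurePreserving_addRight {m : ℕ → ℕ} [∀ k, NeZero (m k)] {μ : Measure (G m)}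
    [IsProbabilityMeasure μ]
    (hμ : ∀ (n : ℕ) (x : G m), μ {y : G m | ∀ j < n, y j = x j} = (M m n : ℝ≥0∞)⁻¹)
    (e : G m) : MeasurePreserving (MeasurableEquiv.addRight e) μ μ := by
  refine ⟨(MeasurableEquiv.addRight e).measurable, ?_⟩
  refine (ext_of_generate_finite _ (generateFrom_cylinders m) (isPiSystem_cylinders m) ?_ ?_).symm
  · rintro s (rfl | ⟨n, x, rfl⟩)
    · simp
    · rw [MeasurableEquiv.map_apply, hμ, ← hμ n (x - e)]
      congr 1
      ext y
      simp [eq_sub_iff_add_eq]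
  · rw [MeasurableEquiv.map_apply, Set.preimage_univ]

theorem integral_eq_zero_of_add_eq_mul {m : ℕ → ℕ} [∀ k, NeZero (m k)] {μ : Measure (G m)}
    [IsProbabilityMeasure μ]
    (hμ : ∀ (n : ℕ) (x : G m), μ {y : G m | ∀ j < n, y j = x j} = (M m n : ℝ≥0∞)⁻¹)
    {e : G m} {w : ℂ} (hw : w ≠ 1) {h : G m → ℂ} (hh : ∀ x, h (x + e) = w * h x) :
    ∫ x, h x ∂μ = 0 := by
  have h1 := (measurePreserving_addRight hμ e).integral_comp' h
  simp only [MeasurableEquiv.coe_addRight, hh, integral_const_mul] at h1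
  have h2 : (w - 1) * ∫ x, h x ∂μ = 0 := by rw [sub_mul, h1]; ring
  exact (mul_eq_zero.1 h2).resolve_left (sub_ne_zero.2 hw)

theorem conj_stdAddChar_one_ne_one {N : ℕ} [NeZero N] (hN : 2 ≤ N) :
    (starRingEnd ℂ) (ZMod.stdAddChar (1 : ZMod N)) ≠ 1 := by
  have : Fact (1 < N) := ⟨hN⟩
  intro h
  rw [map_eq_one_iff _ (starRingEnd ℂ).injective,
    ← AddChar.map_zero_eq_one (ZMod.stdAddChar (N := N))] at h
  exact one_ne_zero (ZMod.injective_stdAddChar h)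

theorem integral_mul_conj_rad_eq_zero {m : ℕ → ℕ} [∀ k, NeZero (m k)] (hm2 : ∀ k, 2 ≤ m k)
    {μ : Measure (G m)} [IsProbabilityMeasure μ]
    (hμ : ∀ (n : ℕ) (x : G m), μ {y : G m | ∀ j < n, y j = x j} = (M m n : ℝ≥0∞)⁻¹)
    {n : ℕ} {g : G m → ℂ} (hg : ∀ x, g (x + Pi.single n 1) = g x) :
    ∫ x, g x * (starRingEnd ℂ) (rad m n x) ∂μ = 0 := by
  refine integral_eq_zero_of_add_eq_mul hμ (e := Pi.single n 1)
    (conj_stdAddChar_one_ne_one (hm2 n)) fun x => ?_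
  rw [hg, rad_add_single, map_mul]
  ring

theorem rad_mul_conj_self (m : ℕ → ℕ) [∀ k, NeZero (m k)] (n : ℕ) (x : G m) :
    rad m n x * (starRingEnd ℂ) (rad m n x) = 1 := by
  simp [Complex.mul_conj', norm_rad]

theorem integral_rad_mul_conj_rad {m : ℕ → ℕ} [∀ k, NeZero (m k)] (hm2 : ∀ k, 2 ≤ m k)
    {μ : Measure (G m)} [IsProbabilityMeasure μ]
    (hμ : ∀ (n : ℕ) (x : G m), μ {y : G m | ∀ j < n, y j = x j} = (M m n : ℝ≥0∞)⁻¹) (k n : ℕ) :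
    ∫ x, rad m k x * (starRingEnd ℂ) (rad m n x) ∂μ = if k = n then 1 else 0 := by
  split_ifs with h
  · subst h
    simp [rad_mul_conj_self]
  · exact integral_mul_conj_rad_eq_zero hm2 hμ (rad_add_single_of_ne m h)

theorem integral_psi_mul_conj_rad {m : ℕ → ℕ} [∀ k, NeZero (m k)] (hm2 : ∀ k, 2 ≤ m k)
    {μ : Measure (G m)} [IsProbabilityMeasure μ]
    (hμ : ∀ (n : ℕ) (x : G m), μ {y : G m | ∀ j < n, y j = x j} = (M m n : ℝ≥0∞)⁻¹)
    {i n : ℕ} (hi : i ≤ M m n) :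
    ∫ x, psi m i x * (starRingEnd ℂ) (rad m n x) ∂μ = if i = M m n then 1 else 0 := by
  split_ifs with h
  · simp [h, psi_M hm2, rad_mul_conj_self]
  · exact integral_mul_conj_rad_eq_zero hm2 hμ (psi_add_single_of_lt (lt_of_le_of_ne hi h))

theorem A_zero (a : ℝ) : A a 0 = 1 := by simp [A]

theorem A_succ (a : ℝ) (n : ℕ) : A a (n + 1) = A a n * (1 + a / (n + 1)) := by
  have : (n.factorial : ℝ) ≠ 0 := by positivity
  simp only [A, Finset.prod_range_succ, Nat.factorial_succ]
  push_cast
  field_simp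
  ring

theorem A_neg_pos {a : ℝ} (ha : a ∈ Set.Ioo (0 : ℝ) 1) (n : ℕ) : 0 < A (-a) n := by
  refine div_pos (Finset.prod_pos fun i _ => ?_) (by positivity)
  have : (0 : ℝ) ≤ i := i.cast_nonneg
  linarith [ha.2]

theorem A_neg_le {a : ℝ} (ha : a ∈ Set.Ioo (0 : ℝ) 1) (n : ℕ) :
    A (-a) n ≤ ((n : ℝ) + 1) ^ (-a) := by
  induction n with
  | zero => simp [A_zero]
  | succ n ih =>
    set s : ℝ := 1 / (n + 1) with hs
    have hn : (0 : ℝ) < n + 1 := by positivity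
    have hs0 : 0 < s := by positivity
    have hs1 : s ≤ 1 := by
      rw [hs, div_le_one hn]
      linarith [(n.cast_nonneg : (0 : ℝ) ≤ n)]
    have has : a * s ≤ 1 := by nlinarith [ha.1, ha.2]
    have hb : (1 + s) ^ a ≤ 1 + a * s :=
      rpow_one_add_le_one_add_mul_self (by linarith) ha.1.le ha.2.le
    have hp : 0 < (1 + s) ^ a := by positivity
    have hkey : 1 - a * s ≤ (1 + s) ^ (-a) := by
      rw [Real.rpow_neg (by positivity), ← one_div, le_div_iff₀ hp]
      calc (1 - a * s) * (1 + s) ^ a ≤ (1 - a * s) * (1 + a * s) :=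
            mul_le_mul_of_nonneg_left hb (sub_nonneg.2 has)
        _ ≤ 1 := by nlinarith [sq_nonneg (a * s)]
    have hfac : (((n + 1 : ℕ) : ℝ) + 1) = (n + 1) * (1 + s) := by
      rw [hs]
      push_cast
      field_simp
    have hneg : 1 + -a / ((n : ℝ) + 1) = 1 - a * s := by rw [hs]; ring
    rw [A_succ, hfac, Real.mul_rpow hn.le (by positivity), hneg]
    exact mul_le_mul ih hkey (by linarith) (by positivity)

theorem A_neg_le_rpow {a : ℝ} (ha : a ∈ Set.Ioo (0 : ℝ) 1) {n : ℕ} (hn : 0 < n) :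
    A (-a) n ≤ (n : ℝ) ^ (-a) :=
  (A_neg_le ha n).trans <| Real.rpow_le_rpow_of_nonpos (by positivity) (by linarith)
    (by linarith [ha.1])

theorem summable_M_rpow {m : ℕ → ℕ} (hm2 : ∀ k, 2 ≤ m k) {s : ℝ} (hs : 0 < s) :
    Summable fun j : ℕ => (M m (j + 1) : ℝ) ^ (-s) := by
  refine Summable.of_nonneg_of_le (fun j => by positivity) (fun j => ?_)
    (summable_geometric_of_lt_one (r := (2 : ℝ) ^ (-s)) (by positivity)
      (Real.rpow_lt_one_of_one_lt_of_neg one_lt_two (neg_neg_of_pos hs)))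
  have h : (2 : ℝ) ^ j ≤ M m (j + 1) := by
    exact_mod_cast (Nat.pow_le_pow_right two_pos j.le_succ).trans (two_pow_le_M hm2 (j + 1))
  refine (Real.rpow_le_rpow_of_nonpos (by positivity) h (by linarith)).trans_eq ?_
  rw [← Real.rpow_natCast, ← Real.rpow_mul two_pos.le, ← Real.rpow_natCast,
    ← Real.rpow_mul two_pos.le, mul_comm]

/-- Coefficients of an absolutely convergent diagonal Rademacher series. -/
theorem integral_tsum_rad_mul_conj_rad {m : ℕ → ℕ} [∀ k, NeZero (m k)] (hm2 : ∀ k, 2 ≤ m k)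
    {μ : Measure (G m)} [IsProbabilityMeasure μ]
    (hμ : ∀ (n : ℕ) (x : G m), μ {y : G m | ∀ j < n, y j = x j} = (M m n : ℝ≥0∞)⁻¹)
    {c : ℕ → ℂ} (hc : Summable fun j => ‖c j‖) (n : ℕ) :
    ∫ z : G m × G m, (∑' j, c j * rad m (j + 1) z.1 * rad m (j + 1) z.2) *
      (starRingEnd ℂ) (rad m (n + 1) z.1) * (starRingEnd ℂ) (rad m (n + 1) z.2) ∂(μ.prod μ)
      = c n := by
  set F : ℕ → G m × G m → ℂ := fun j z => c j *
    ((rad m (j + 1) z.1 * (starRingEnd ℂ) (rad m (n + 1) z.1)) *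
      (rad m (j + 1) z.2 * (starRingEnd ℂ) (rad m (n + 1) z.2))) with hF
  have hnorm : ∀ j z, ‖F j z‖ = ‖c j‖ := fun j z => by simp [hF, norm_rad]
  have hmeas : ∀ j, Measurable (F j) := fun j => by
    have := Complex.continuous_conj.measurable
    simp only [hF]
    fun_prop
  have hsum := hasSum_integral_of_summable_integral_norm (μ := μ.prod μ) (F := F)
    (fun j => Integrable.of_bound (hmeas j).aestronglyMeasurable ‖c j‖
      (ae_of_all _ fun z => (hnorm j z).le)) (by simpa [hnorm] using hc)
  have hint : ∀ j, ∫ z, F j z ∂(μ.prod μ) = if j = n then c n else 0 := fun j => by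
    simp only [hF]
    rw [integral_const_mul, integral_prod_mul
      (fun x => rad m (j + 1) x * (starRingEnd ℂ) (rad m (n + 1) x))
      (fun x => rad m (j + 1) x * (starRingEnd ℂ) (rad m (n + 1) x)),
      integral_rad_mul_conj_rad hm2 hμ]
    rcases eq_or_ne j n with rfl | h
    · simp
    · simp [h]
  simp only [hint] at hsum
  refine Eq.trans ?_ (hsum.unique (hasSum_ite_eq n (c n)))
  congr 1
  ext z
  rw [← tsum_mul_right, ← tsum_mul_right]
  exact tsum_congr fun j => by simp only [hF]; ring

theorem integrable_tsum_rad {m : ℕ → ℕ} [∀ k, NeZero (m k)]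
    {μ : Measure (G m)} [IsProbabilityMeasure μ] {c : ℕ → ℂ} (hc : Summable fun j => ‖c j‖) :
    Integrable (fun z : G m × G m => ∑' j, c j * rad m (j + 1) z.1 * rad m (j + 1) z.2)
      (μ.prod μ) := by
  have hnorm : ∀ j (z : G m × G m), ‖c j * rad m (j + 1) z.1 * rad m (j + 1) z.2‖ = ‖c j‖ :=
    fun j z => by simp [norm_rad]
  refine Integrable.of_bound (Measurable.tsum fun j => ?_).aestronglyMeasurable (∑' j, ‖c j‖)
    (ae_of_all _ fun z => ?_)
  · fun_prop
  · refine (norm_tsum_le_tsum_norm (by simpa only [hnorm] using hc)).trans_eq ?_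
    simp only [hnorm]

theorem integrable_psi_mul_psi {m : ℕ → ℕ} [∀ k, NeZero (m k)]
    {μ : Measure (G m)} [IsProbabilityMeasure μ] (i j : ℕ) :
    Integrable (fun z : G m × G m => psi m i z.1 * psi m j z.2) (μ.prod μ) :=
  Integrable.of_bound (by fun_prop) 1 (ae_of_all _ fun z => by simp [norm_psi])

theorem integrable_mul_conj_rad_mul_conj_rad {m : ℕ → ℕ} [∀ k, NeZero (m k)]
    {μ : Measure (G m)} [IsProbabilityMeasure μ] {F : G m × G m → ℂ}
    (hF : Integrable F (μ.prod μ)) (n : ℕ) :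
    Integrable (fun z => F z * ((starRingEnd ℂ) (rad m n z.1) * (starRingEnd ℂ) (rad m n z.2)))
      (μ.prod μ) := by
  have := Complex.continuous_conj.measurable
  refine hF.mul_bdd (c := 1) (Measurable.aestronglyMeasurable (by fun_prop))
    (ae_of_all _ fun z => by simp [norm_rad])

theorem integrable_cesaro2 {m : ℕ → ℕ} [∀ k, NeZero (m k)]
    {μ : Measure (G m)} [IsProbabilityMeasure μ] (α β : ℝ) (f : G m × G m → ℂ) (n₁ n₂ : ℕ) :
    Integrable (cesaro2 m μ α β f n₁ n₂) (μ.prod μ) := by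
  unfold cesaro2
  refine Integrable.const_mul (integrable_finsetSum _ fun i _ =>
    integrable_finsetSum _ fun j _ => ?_) _
  simp only [mul_assoc]
  exact ((integrable_psi_mul_psi i j).const_mul _).const_mul _

theorem integral_cesaro2_mul_conj_rad {m : ℕ → ℕ} [∀ k, NeZero (m k)] (hm2 : ∀ k, 2 ≤ m k)
    {μ : Measure (G m)} [IsProbabilityMeasure μ]
    (hμ : ∀ (n : ℕ) (x : G m), μ {y : G m | ∀ j < n, y j = x j} = (M m n : ℝ≥0∞)⁻¹)
    (α β : ℝ) (f : G m × G m → ℂ) (n : ℕ) :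
    ∫ z, cesaro2 m μ α β f (M m n) (M m n) z *
      ((starRingEnd ℂ) (rad m n z.1) * (starRingEnd ℂ) (rad m n z.2)) ∂(μ.prod μ)
      = ((A (-α) (M m n) * A (-β) (M m n) : ℝ) : ℂ)⁻¹ * fhat2 m μ f (M m n) (M m n) := by
  have hterm : ∀ i ∈ Finset.range (M m n + 1), ∀ j ∈ Finset.range (M m n + 1),
      ∀ a : ℂ, ∫ z : G m × G m, a * ((psi m i z.1 * psi m j z.2) *
        ((starRingEnd ℂ) (rad m n z.1) * (starRingEnd ℂ) (rad m n z.2))) ∂(μ.prod μ)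
        = if i = M m n then (if j = M m n then a else 0) else 0 := by
    intro i hi j hj a
    have := integral_prod_mul (μ := μ) (ν := μ)
      (fun x => psi m i x * (starRingEnd ℂ) (rad m n x))
      (fun x => psi m j x * (starRingEnd ℂ) (rad m n x))
    rw [integral_psi_mul_conj_rad hm2 hμ (Nat.lt_succ_iff.1 (Finset.mem_range.1 hi)),
      integral_psi_mul_conj_rad hm2 hμ (Nat.lt_succ_iff.1 (Finset.mem_range.1 hj))] at this
    rw [integral_const_mul]
    rw [integral_congr_ae (ae_of_all _ fun z => mul_mul_mul_comm _ _ _ _), this]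
    split_ifs <;> simp
  have hint : ∀ i j, ∀ a : ℂ, Integrable (fun z : G m × G m => a * ((psi m i z.1 * psi m j z.2) *
      ((starRingEnd ℂ) (rad m n z.1) * (starRingEnd ℂ) (rad m n z.2)))) (μ.prod μ) :=
    fun i j a => (integrable_mul_conj_rad_mul_conj_rad (integrable_psi_mul_psi i j) n).const_mul a
  simp only [cesaro2, mul_assoc (((A (-α) (M m n) * A (-β) (M m n) : ℝ) : ℂ)⁻¹)]
  rw [integral_const_mul]
  congr 1
  simp only [Finset.sum_mul]
  have hassoc : ∀ a b c d e : ℂ, a * b * c * d * e = (a * b) * ((c * d) * e) := by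
    intros; ring
  simp only [hassoc]
  rw [integral_finsetSum _ fun i _ => integrable_finsetSum _ fun j _ => hint i j _]
  rw [Finset.sum_congr rfl fun i hi => (integral_finsetSum _ fun j _ => hint i j _).trans
    (Finset.sum_congr rfl fun j hj => hterm i hi j hj _)]
  simp [A_zero]

theorem statement_17 (m : ℕ → ℕ) (hm2 : ∀ k, 2 ≤ m k) (hmbd : ∃ B, ∀ k, m k ≤ B)
    (μ : Measure (G m)) [IsProbabilityMeasure μ]
    (hμ : ∀ (n : ℕ) (x : G m), μ {y : G m | ∀ j < n, y j = x j} = (M m n : ℝ≥0∞)⁻¹)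
    (α β : ℝ) (hα : α ∈ Set.Ioo (0 : ℝ) 1) (hβ : β ∈ Set.Ioo (0 : ℝ) 1) (hαβ : α + β < 1) (f₀ : G m × G m → ℂ)
    (hf₀ : ∀ z : G m × G m, f₀ z = ∑' j : ℕ,
      (((M m (j + 1) : ℝ) ^ (-(α + β)) : ℝ) : ℂ) * rad m (j + 1) z.1 * rad m (j + 1) z.2) :
    ∃ c : ℝ≥0, 0 < c ∧ ∃ N : ℕ,
      (∀ n : ℕ, N ≤ n → (c : ℝ≥0∞) ≤
        eLpNorm (fun z => cesaro2 m μ α β f₀ (M m n) (M m n) z - f₀ z) 1 (μ.prod μ)) ∧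
      0 < Filter.limsup (fun n =>
        eLpNorm (fun z => cesaro2 m μ α β f₀ (M m n) (M m n) z - f₀ z) 1 (μ.prod μ)) atTop := by
  have : ∀ k, NeZero (m k) := fun k => ⟨by have := hm2 k; omega⟩
  have hs : 0 < α + β := add_pos hα.1 hβ.1
  set c : ℕ → ℂ := fun j => (((M m (j + 1) : ℝ) ^ (-(α + β)) : ℝ) : ℂ) with hc
  have hcsum : Summable fun j => ‖c j‖ := by
    refine (summable_M_rpow hm2 hs).congr fun j => ?_
    rw [hc, Complex.norm_real, Real.norm_of_nonneg (by positivity)]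
  obtain rfl : f₀ = fun z => ∑' j, c j * rad m (j + 1) z.1 * rad m (j + 1) z.2 := funext hf₀
  set f : G m × G m → ℂ := fun z => ∑' j, c j * rad m (j + 1) z.1 * rad m (j + 1) z.2 with hf
  have h2 : (2 : ℝ) ^ (-(α + β)) < 1 :=
    Real.rpow_lt_one_of_one_lt_of_neg one_lt_two (neg_neg_of_pos hs)
  have hlower : ∀ n : ℕ, 1 ≤ n → ((1 - (2 : ℝ) ^ (-(α + β))).toNNReal : ℝ≥0∞) ≤
      eLpNorm (fun z => cesaro2 m μ α β f (M m n) (M m n) z - f z) 1 (μ.prod μ) := by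
    intro n hn
    obtain ⟨k, rfl⟩ := Nat.exists_eq_add_of_le' hn
    set L := M m (k + 1) with hL
    have hLpos : 0 < L := M_pos hm2 _
    have hfI : Integrable f (μ.prod μ) := integrable_tsum_rad hcsum
    have hcoef := integral_tsum_rad_mul_conj_rad hm2 hμ hcsum k
    have hfhat : fhat2 m μ f L L = c k := by
      simpa only [fhat2, hL, psi_M hm2] using hcoef
    have hpair : ∫ z, (cesaro2 m μ α β f L L z - f z) * ((starRingEnd ℂ) (rad m (k + 1) z.1) *
        (starRingEnd ℂ) (rad m (k + 1) z.2)) ∂(μ.prod μ) =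
        ((((A (-α) L * A (-β) L)⁻¹ - 1) * (L : ℝ) ^ (-(α + β)) : ℝ) : ℂ) := by
      simp only [sub_mul _ (f _)]
      rw [integral_sub
        (integrable_mul_conj_rad_mul_conj_rad (integrable_cesaro2 α β f L L) (k + 1))
        (integrable_mul_conj_rad_mul_conj_rad hfI (k + 1)),
        integral_cesaro2_mul_conj_rad hm2 hμ, hfhat]
      simp only [← mul_assoc]
      rw [hcoef, hc]
      push_cast
      ring
    have hA : 0 < A (-α) L * A (-β) L := mul_pos (A_neg_pos hα L) (A_neg_pos hβ L)
    have hAle : A (-α) L * A (-β) L ≤ (L : ℝ) ^ (-(α + β)) := by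
      rw [neg_add, Real.rpow_add (by positivity)]
      exact mul_le_mul (A_neg_le_rpow hα hLpos) (A_neg_le_rpow hβ hLpos) (A_neg_pos hβ L).le
        (by positivity)
    have hL2 : (2 : ℝ) ≤ L := by
      have := (Nat.pow_le_pow_right two_pos (Nat.le_add_left 1 k)).trans (two_pow_le_M hm2 (k + 1))
      exact_mod_cast this
    have hval : 1 - (2 : ℝ) ^ (-(α + β)) ≤
        ((A (-α) L * A (-β) L)⁻¹ - 1) * (L : ℝ) ^ (-(α + β)) := by
      have h3 : (L : ℝ) ^ (-(α + β)) ≤ 2 ^ (-(α + β)) :=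
        Real.rpow_le_rpow_of_nonpos two_pos hL2 (by linarith)
      have h4 : 1 ≤ (A (-α) L * A (-β) L)⁻¹ * (L : ℝ) ^ (-(α + β)) := by
        rwa [inv_mul_eq_div, one_le_div hA]
      linarith
    have hbound := enorm_integral_le_lintegral_enorm (μ := μ.prod μ)
      fun z => (cesaro2 m μ α β f L L z - f z) * ((starRingEnd ℂ) (rad m (k + 1) z.1) *
        (starRingEnd ℂ) (rad m (k + 1) z.2))
    rw [hpair] at hbound
    have henorm : ∀ x : G m, ‖(starRingEnd ℂ) (rad m (k + 1) x)‖ₑ = 1 := fun x => by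
      rw [← ofReal_norm, RCLike.norm_conj, norm_rad, ENNReal.ofReal_one]
    simp only [enorm_mul, henorm, mul_one] at hbound
    rw [eLpNorm_one_eq_lintegral_enorm]
    refine le_trans ?_ hbound
    rw [← ofReal_norm, Complex.norm_real]
    exact ENNReal.ofReal_le_ofReal (hval.trans (Real.le_norm_self _))
  refine ⟨_, Real.toNNReal_pos.2 (sub_pos.2 h2), 1, hlower, ?_⟩
  refine lt_of_lt_of_le (ENNReal.coe_pos.2 (Real.toNNReal_pos.2 (sub_pos.2 h2)))
    (le_limsup_of_frequently_le ?_)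
  exact (eventually_atTop.2 ⟨1, hlower⟩).frequently

end Vilenkin
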